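/- arXiv:0707.3991 — 3 statements merged into one kernel-verified Lean document; each statement's English description precedes it below -/
import Mathlib

section
/- Let α ≥ 0 be a real constant and let f : [0,1] → ℝ be a continuously differentiable function that is not identically zero. Then the Rayleigh–Ritz ratio of f satisfies the lower bound α·(f(0)² + f(1)²) + ∫₀¹ (f′(z))² dz ≥ ((−α + √(α² + 8π²α)) / (4π))² · ∫₀¹ f(z)² dz. -/
open Real intervalIntegral

lemma rr_aux (k : ℝ) (hk0 : 0 ≤ k) (hkpi : k < π) (f : ℝ → ℝ) (hf : ContDiff ℝ 1 f) :
    k ^ 2 * (∫ z in (0 : ℝ)..1, (f z) ^ 2) - k * tan (k / 2) * (f 0 ^ 2 + f 1 ^ 2)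
      ≤ ∫ z in (0 : ℝ)..1, (deriv f z) ^ 2 := by
  have hcf : Continuous f := hf.continuous
  have hcd : Continuous (deriv f) := hf.continuous_deriv le_rfl
  have hcos : ∀ z ∈ Set.uIcc (0 : ℝ) 1, cos (k * (z - 1 / 2)) ≠ 0 := by
    intro z hz
    rw [Set.uIcc_of_le zero_le_one] at hz
    apply ne_of_gt
    apply cos_pos_of_mem_Ioo
    constructor <;> nlinarith [hz.1, hz.2]
  let d : ℝ → ℝ := fun z => 2 * f z * deriv f z * (-k * tan (k * (z - 1 / 2)))
    + f z ^ 2 * (-k * (1 / cos (k * (z - 1 / 2)) ^ 2 * k))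
  have hder : ∀ z ∈ Set.uIcc (0 : ℝ) 1,
      HasDerivAt (fun z => f z ^ 2 * (-k * tan (k * (z - 1 / 2)))) (d z) z := by
    intro z hz
    have h1 : HasDerivAt f (deriv f z) z :=
      (hf.differentiable one_ne_zero z).hasDerivAt
    have h2 : HasDerivAt (fun z : ℝ => k * (z - 1 / 2)) k z := by
      simpa using ((hasDerivAt_id z).sub_const (1 / 2 : ℝ)).const_mul k
    have h3 := ((hasDerivAt_tan (hcos z hz)).comp z h2).const_mul (-k)
    have h4 := (h1.pow 2).mul h3
    refine HasDerivAt.congr_deriv h4 ?_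
    simp [d]
  have hdc : ContinuousOn d (Set.uIcc (0 : ℝ) 1) := by
    have hc : ContinuousOn (fun z : ℝ => cos (k * (z - 1 / 2))) (Set.uIcc (0 : ℝ) 1) := by
      fun_prop
    have ht : ContinuousOn (fun z : ℝ => tan (k * (z - 1 / 2))) (Set.uIcc (0 : ℝ) 1) := by
      simp only [tan_eq_sin_div_cos]
      exact ContinuousOn.div (by fun_prop) hc hcos
    have hi : ContinuousOn (fun z : ℝ => 1 / cos (k * (z - 1 / 2)) ^ 2)
        (Set.uIcc (0 : ℝ) 1) :=
      ContinuousOn.div (by fun_prop) (hc.pow 2) (fun z hz => pow_ne_zero 2 (hcos z hz))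
    simp only [d]
    exact (((by fun_prop : Continuous fun z => 2 * f z * deriv f z).continuousOn).mul
      (continuousOn_const.mul ht)).add ((hcf.pow 2).continuousOn.mul
      (continuousOn_const.mul (hi.mul continuousOn_const)))
  have hint := integral_eq_sub_of_hasDerivAt hder hdc.intervalIntegrable
  have hI : IntervalIntegrable (fun z => k ^ 2 * f z ^ 2) MeasureTheory.volume 0 1 :=
    (by fun_prop : Continuous fun z => k ^ 2 * f z ^ 2).intervalIntegrable _ _
  have hmono : ∫ z in (0 : ℝ)..1, (k ^ 2 * f z ^ 2 + d z) ≤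
      ∫ z in (0 : ℝ)..1, (deriv f z) ^ 2 := by
    apply integral_mono_on zero_le_one (hI.add hdc.intervalIntegrable)
      ((hcd.pow 2).intervalIntegrable _ _)
    intro z hz
    have hc := hcos z (by rwa [Set.uIcc_of_le zero_le_one])
    have e : 1 / cos (k * (z - 1 / 2)) ^ 2 = 1 + tan (k * (z - 1 / 2)) ^ 2 := by
      rw [one_div, ← inv_one_add_tan_sq hc, inv_inv]
    simp only [d, e, Pi.pow_apply]
    nlinarith [sq_nonneg (deriv f z + f z * k * tan (k * (z - 1 / 2)))]
  rw [integral_add hI hdc.intervalIntegrable, hint, integral_const_mul] at hmono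
  have e1 : k * ((1 : ℝ) - 1 / 2) = k / 2 := by ring
  have e0 : k * ((0 : ℝ) - 1 / 2) = -(k / 2) := by ring
  rw [e1, e0, tan_neg] at hmono
  linarith

/-- Rayleigh–Ritz lower bound: for `α ≥ 0` and a continuously differentiable
trial function `f` on `[0,1]` that is not identically zero there,
`α (f 0 ^ 2 + f 1 ^ 2) + ∫ f'^2 ≥ ((-α + √(α² + 8π²α)) / (4π))² ∫ f²`. -/
theorem rayleigh_ritz_lower_bound (α : ℝ) (hα : 0 ≤ α) (f : ℝ → ℝ)
    (hf : ContDiff ℝ 1 f) (hne : ∃ z ∈ Set.Icc (0 : ℝ) 1, f z ≠ 0) :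
    α * (f 0 ^ 2 + f 1 ^ 2) + ∫ z in (0 : ℝ)..1, (deriv f z) ^ 2 ≥
      ((-α + Real.sqrt (α ^ 2 + 8 * Real.pi ^ 2 * α)) / (4 * Real.pi)) ^ 2 *
        ∫ z in (0 : ℝ)..1, (f z) ^ 2 := by
  have hpi := Real.pi_pos
  have hs : Real.sqrt (α ^ 2 + 8 * Real.pi ^ 2 * α) ^ 2 = α ^ 2 + 8 * Real.pi ^ 2 * α :=
    Real.sq_sqrt (by positivity)
  have hsa : α ≤ Real.sqrt (α ^ 2 + 8 * Real.pi ^ 2 * α) := by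
    apply Real.le_sqrt_of_sq_le
    have : 0 ≤ 8 * Real.pi ^ 2 * α := by positivity
    linarith
  set s := Real.sqrt (α ^ 2 + 8 * Real.pi ^ 2 * α) with hsdef
  set k := (-α + s) / (4 * Real.pi) with hk
  have hk0 : 0 ≤ k := div_nonneg (by linarith) (by positivity)
  have hks : s = 4 * π * k + α := by rw [hk]; field_simp; ring
  have hq : 2 * π * k ^ 2 = α * (π - k) := by
    rw [hks] at hs
    have : 8 * π * (2 * π * k ^ 2) = 8 * π * (α * (π - k)) := by linarith
    exact mul_left_cancel₀ (by positivity) this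
  have hkpi : k < π := by
    by_contra hcon
    push Not at hcon
    have h1 : 0 < 2 * π * k ^ 2 := by
      have : 0 < k := by linarith
      positivity
    nlinarith [mul_nonneg hα (sub_nonneg.2 hcon)]
  have htan : k * tan (k / 2) ≤ α := by
    have hc : 1 - k / π ≤ cos (k / 2) := by
      have := Real.one_sub_mul_le_cos (x := k / 2) (by linarith) (by linarith)
      calc 1 - k / π = 1 - 2 / π * (k / 2) := by ring
        _ ≤ _ := this
    have hsin : sin (k / 2) ≤ k / 2 := sin_le (by linarith)
    have hp : 0 < 1 - k / π := by
      rw [sub_pos, div_lt_one hpi]; exact hkpi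
    have hcp : 0 < cos (k / 2) := by linarith
    rw [tan_eq_sin_div_cos, ← mul_div_assoc, div_le_iff₀ hcp]
    have h2 : α * (1 - k / π) = 2 * k ^ 2 := by
      field_simp
      linarith
    nlinarith [mul_le_mul_of_nonneg_left hc hα, mul_le_mul_of_nonneg_left hsin hk0]
  have h := rr_aux k hk0 hkpi f hf
  have : k * tan (k / 2) * (f 0 ^ 2 + f 1 ^ 2) ≤ α * (f 0 ^ 2 + f 1 ^ 2) :=
    mul_le_mul_of_nonneg_right htan (by positivity)
  linarith
end

section
/- Let α ≥ 0. The infimum over all continuously differentiable functions f : [0,1] → ℝ with ∫₀¹ f(z)² dz = 1 of the quantity α·(f(0)² + f(1)²) + ∫₀¹ (f′(z))² dz is greater than or equal to ((−α + √(α² + 8π²α)) / (4π))². -/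
open Real intervalIntegral

lemma aux_energy (k : ℝ) (hk0 : 0 ≤ k) (hk : k < π) (f : ℝ → ℝ) (hf : ContDiff ℝ 1 f) :
    k ^ 2 * (∫ z in (0 : ℝ)..1, (f z) ^ 2) ≤
      k * tan (k / 2) * (f 0 ^ 2 + f 1 ^ 2) + ∫ z in (0 : ℝ)..1, (deriv f z) ^ 2 := by
  have hfc : Continuous f := hf.continuous
  have hdc : Continuous (deriv f) := hf.continuous_deriv le_rfl
  have hcos : ∀ z ∈ Set.uIcc (0:ℝ) 1, cos (k * (z - 1 / 2)) ≠ 0 := by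
    intro z hz
    rw [Set.uIcc_of_le zero_le_one] at hz
    apply ne_of_gt
    apply cos_pos_of_mem_Ioo
    constructor
    · nlinarith [hz.1, hz.2, mul_nonneg hk0 hz.1]
    · nlinarith [hz.1, hz.2, mul_nonneg hk0 (sub_nonneg.2 hz.2)]
  have hg : ContinuousOn (fun z : ℝ => k * tan (k * (z - 1 / 2))) (Set.uIcc 0 1) := by
    apply continuousOn_const.mul
    apply continuousOn_tan.comp (by fun_prop)
    intro z hz
    exact hcos z hz
  set g : ℝ → ℝ := fun z : ℝ => k * tan (k * (z - 1 / 2)) with hgdef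
  have hgd : ∀ z ∈ Set.uIcc (0:ℝ) 1, HasDerivAt g (k ^ 2 + g z ^ 2) z := by
    intro z hz
    have h1 : HasDerivAt (fun z : ℝ => k * (z - 1 / 2)) (k * 1) z :=
      ((hasDerivAt_id z).sub_const _).const_mul k
    have h2 := ((hasDerivAt_tan (hcos z hz)).comp z h1).const_mul k
    refine HasDerivAt.congr_deriv (f := g) h2 ?_
    simp only [hgdef, tan_eq_sin_div_cos]
    have := hcos z hz
    have h3 := sin_sq_add_cos_sq (k * (z - 1 / 2))
    generalize k * (z - 1 / 2) = x at this h3 ⊢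
    field_simp
    linear_combination -(k ^ 2) * h3
  have hFd : ∀ z ∈ Set.uIcc (0:ℝ) 1, HasDerivAt (fun z => g z * f z ^ 2)
      ((k ^ 2 + g z ^ 2) * f z ^ 2 + g z * (2 * f z * deriv f z)) z := by
    intro z hz
    have h1 : HasDerivAt f (deriv f z) z :=
      ((hf.differentiable one_ne_zero) z).hasDerivAt
    refine HasDerivAt.congr_deriv (f := fun z => g z * f z ^ 2)
      ((hgd z hz).mul (h1.pow 2)) ?_
    simp
  have hint : IntervalIntegrable (fun z => (k ^ 2 + g z ^ 2) * f z ^ 2 +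
      g z * (2 * f z * deriv f z)) MeasureTheory.volume 0 1 := by
    apply ContinuousOn.intervalIntegrable
    have := hfc.continuousOn (s := Set.uIcc (0:ℝ) 1)
    have := hdc.continuousOn (s := Set.uIcc (0:ℝ) 1)
    fun_prop
  have hFTC := integral_eq_sub_of_hasDerivAt hFd hint
  have hi1 : IntervalIntegrable (fun z => k ^ 2 * f z ^ 2) MeasureTheory.volume 0 1 :=
    Continuous.intervalIntegrable (by fun_prop) _ _
  have hi2 : IntervalIntegrable (fun z => deriv f z ^ 2) MeasureTheory.volume 0 1 :=
    Continuous.intervalIntegrable (by fun_prop) _ _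
  have hm := integral_mono_on (zero_le_one) hi1 (hint.add hi2) (by
    intro z _
    nlinarith [sq_nonneg (deriv f z + g z * f z)])
  rw [integral_add hint hi2, hFTC, intervalIntegral.integral_const_mul] at hm
  have e1 : g 1 = k * tan (k / 2) := by simp only [hgdef]; congr 2; ring
  have e0 : g 0 = -(k * tan (k / 2)) := by
    simp only [hgdef]
    rw [← mul_neg, ← tan_neg]; congr 2; ring
  rw [e1, e0] at hm
  linarith

/-- The infimum of the Rayleigh quotient numerator over normalized `C¹`
trial functions is at least `((-α + √(α² + 8π²α)) / (4π))²`. -/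
theorem rayleigh_ritz_inf_lower_bound (α : ℝ) (hα : 0 ≤ α) :
    sInf {E : ℝ | ∃ f : ℝ → ℝ, ContDiff ℝ 1 f ∧
        (∫ z in (0 : ℝ)..1, (f z) ^ 2) = 1 ∧
        E = α * (f 0 ^ 2 + f 1 ^ 2) + ∫ z in (0 : ℝ)..1, (deriv f z) ^ 2} ≥
      ((-α + Real.sqrt (α ^ 2 + 8 * Real.pi ^ 2 * α)) / (4 * Real.pi)) ^ 2 := by
  have hpi := Real.pi_pos
  have hs : Real.sqrt (α ^ 2 + 8 * Real.pi ^ 2 * α) ^ 2 = α ^ 2 + 8 * Real.pi ^ 2 * α :=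
    Real.sq_sqrt (by positivity)
  have hsα : α ≤ Real.sqrt (α ^ 2 + 8 * Real.pi ^ 2 * α) :=
    Real.le_sqrt_of_sq_le (by nlinarith [mul_nonneg (sq_nonneg π) hα])
  obtain ⟨k, hk⟩ : ∃ k, k = (-α + Real.sqrt (α ^ 2 + 8 * Real.pi ^ 2 * α)) / (4 * Real.pi) :=
    ⟨_, rfl⟩
  rw [← hk]
  have hk0 : 0 ≤ k := by rw [hk]; apply div_nonneg <;> linarith
  have hs' : Real.sqrt (α ^ 2 + 8 * Real.pi ^ 2 * α) = 4 * π * k + α := by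
    rw [hk]; field_simp; ring
  rw [hs'] at hs
  have hq : 2 * π * k ^ 2 = α * (π - k) := by
    have : 8 * π * (2 * π * k ^ 2) = 8 * π * (α * (π - k)) := by linear_combination hs
    exact mul_left_cancel₀ (by positivity) this
  have hkpi : k < π := by
    by_contra h
    push Not at h
    have h1 : 0 < k := by linarith
    have h2 : 0 < 2 * π * k ^ 2 := by positivity
    nlinarith [mul_nonneg hα (sub_nonneg.2 h)]
  have htan : k * tan (k / 2) ≤ α := by
    have hc : 0 < cos (k / 2) := cos_pos_of_mem_Ioo ⟨by linarith, by linarith⟩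
    have hsin : sin (k / 2) ≤ k / 2 := sin_le (by linarith)
    have hcos : 1 - 2 / π * (k / 2) ≤ cos (k / 2) :=
      one_sub_mul_le_cos (by linarith) (by linarith)
    rw [tan_eq_sin_div_cos, ← mul_div_assoc, div_le_iff₀ hc]
    have h1 : α * (1 - 2 / π * (k / 2)) = 2 * k ^ 2 := by
      field_simp; linear_combination -hq
    nlinarith [mul_le_mul_of_nonneg_left hcos hα, mul_le_mul_of_nonneg_left hsin hk0, sq_nonneg k]
  apply le_csInf
  · exact ⟨_, fun _ => 1, contDiff_const, by simp, rfl⟩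
  · rintro E ⟨f, hf, hn, rfl⟩
    have h := aux_energy k hk0 hkpi f hf
    rw [hn] at h
    nlinarith [mul_le_mul_of_nonneg_right htan (by positivity : 0 ≤ f 0 ^ 2 + f 1 ^ 2)]
end

section
/- Let x, y : ℝ → ℝ be twice continuously differentiable functions parametrizing a curve, fix θ ∈ ℝ, and set w(θ) = ((x′(θ))² + (y′(θ))²)^{1/2}, assumed nonzero. Define r(ψ) = ((x(θ) − x(ψ))² + (y(θ) − y(ψ))²)^{1/2}. Then the kernel (1/(2π r(ψ)² w(θ)))·[x′(θ)(y(θ) − y(ψ)) − y′(θ)(x(θ) − x(ψ))] tends to the limit (1/(4π w(θ)³))·[x″(θ) y′(θ) − y″(θ) x′(θ)] as ψ → θ. -/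
open Real Filter Topology

lemma second_order_quotient (f : ℝ → ℝ) (hf : ContDiff ℝ 2 f) (θ : ℝ) :
    Tendsto (fun ψ : ℝ => (f ψ - f θ - deriv f θ * (ψ - θ)) / (ψ - θ) ^ 2)
      (𝓝[≠] θ) (𝓝 (deriv (deriv f) θ / 2)) := by
  have h := (taylor_isLittleO_univ (x₀ := θ) (n := 2) (by exact_mod_cast hf)).tendsto_div_nhds_zero
  have h1 := (h.mono_left (nhdsWithin_le_nhds (s := {θ}ᶜ))).add_const (deriv (deriv f) θ / 2)
  rw [zero_add] at h1
  refine h1.congr' ?_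
  filter_upwards [self_mem_nhdsWithin] with ψ hψ
  have hne : ψ - θ ≠ 0 := sub_ne_zero.mpr hψ
  simp only [taylorWithinEval_succ, taylor_within_zero_eval, iteratedDerivWithin_univ,
    iteratedDeriv_succ, iteratedDeriv_zero, smul_eq_mul]
  norm_num
  field_simp
  ring

/-- The normal derivative of the logarithmic kernel tends to the curvature
expression `(x″ y′ − y″ x′) / (4π w³)` as `ψ → θ`. -/
theorem log_kernel_normal_derivative_limit (x y : ℝ → ℝ)
    (hx : ContDiff ℝ 2 x) (hy : ContDiff ℝ 2 y) (θ : ℝ)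
    (hw : Real.sqrt ((deriv x θ) ^ 2 + (deriv y θ) ^ 2) ≠ 0) :
    Tendsto
      (fun ψ : ℝ =>
        (1 / (2 * Real.pi * ((x θ - x ψ) ^ 2 + (y θ - y ψ) ^ 2) *
            Real.sqrt ((deriv x θ) ^ 2 + (deriv y θ) ^ 2))) *
          (deriv x θ * (y θ - y ψ) - deriv y θ * (x θ - x ψ)))
      (𝓝[≠] θ)
      (𝓝 ((1 / (4 * Real.pi * (Real.sqrt ((deriv x θ) ^ 2 + (deriv y θ) ^ 2)) ^ 3)) *
        (deriv (deriv x) θ * deriv y θ - deriv (deriv y) θ * deriv x θ))) := by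
  have hsq : Real.sqrt ((deriv x θ) ^ 2 + (deriv y θ) ^ 2) ^ 2
      = (deriv x θ) ^ 2 + (deriv y θ) ^ 2 := Real.sq_sqrt (by positivity)
  set w := Real.sqrt ((deriv x θ) ^ 2 + (deriv y θ) ^ 2) with hwdef
  have hpi := Real.pi_ne_zero
  have ax := second_order_quotient x hx θ
  have ay := second_order_quotient y hy θ
  have sx := ((hx.differentiable (by norm_num)) θ).hasDerivAt.tendsto_slope
  have sy := ((hy.differentiable (by norm_num)) θ).hasDerivAt.tendsto_slope
  have hden : 2 * Real.pi * ((deriv x θ) ^ 2 + (deriv y θ) ^ 2) * w ≠ 0 := by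
    rw [← hsq]; positivity
  have key := ((((((sx.pow 2).add (sy.pow 2)).const_mul (2 * Real.pi)).mul_const w).inv₀ hden).mul
    ((ax.const_mul (deriv y θ)).sub (ay.const_mul (deriv x θ))))
  have hlim : (2 * Real.pi * ((deriv x θ) ^ 2 + (deriv y θ) ^ 2) * w)⁻¹ *
      (deriv y θ * (deriv (deriv x) θ / 2) - deriv x θ * (deriv (deriv y) θ / 2))
      = (1 / (4 * Real.pi * w ^ 3)) *
        (deriv (deriv x) θ * deriv y θ - deriv (deriv y) θ * deriv x θ) := by
    rw [← hsq]
    field_simp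
    ring
  rw [hlim] at key
  refine key.congr' ?_
  filter_upwards [self_mem_nhdsWithin] with ψ hψ
  have hne : ψ - θ ≠ 0 := sub_ne_zero.mpr hψ
  simp only [slope_def_field]
  have e1 : 2 * Real.pi * ((x θ - x ψ) ^ 2 + (y θ - y ψ) ^ 2) * w
      = (2 * Real.pi * (((x ψ - x θ) / (ψ - θ)) ^ 2 + ((y ψ - y θ) / (ψ - θ)) ^ 2) * w)
        * (ψ - θ) ^ 2 := by
    field_simp
    ring
  have e2 : deriv x θ * (y θ - y ψ) - deriv y θ * (x θ - x ψ)
      = (ψ - θ) ^ 2 * (deriv y θ * ((x ψ - x θ - deriv x θ * (ψ - θ)) / (ψ - θ) ^ 2)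
        - deriv x θ * ((y ψ - y θ - deriv y θ * (ψ - θ)) / (ψ - θ) ^ 2)) := by
    field_simp
    ring
  have e3 : ∀ a b c : ℝ, c ≠ 0 → a⁻¹ * b = 1 / (a * c) * (c * b) := by
    intro a b c hc
    rw [one_div, mul_inv, mul_assoc, inv_mul_cancel_left₀ hc]
  rw [e1, e2]
  exact e3 _ _ _ (pow_ne_zero 2 hne)
end
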